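/- Let 0 → C¹ →^I C² →^P C³ → 0 be a short exact sequence of cochain complexes of finite-dimensional complex inner product spaces: I : C¹ → C² and P : C² → C³ are morphisms of complexes such that for every i the map I_i is injective, the map P_i is surjective, and range I_i = ker P_i. Assume C¹, C², C³ are all acyclic. Then log T(C²) = log T(C¹) + log T(C³) − Σ_i (−1)^i log T(S_i), where S_i denotes the acyclic three-term cochain complex 0 → C¹_i →^{I_i} C²_i →^{P_i} C³_i → 0, placed in degrees 0, 1, 2. -/

import Mathlib

noncomputable section

open LinearMap

/-- A cochain complex of finite-dimensional complex inner product spaces,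
supported in degrees `0, …, N` (the spaces in degrees `> N` are trivial). -/
structure FinComplex (N : ℕ) where
  /-- the spaces of the complex -/
  C : ℕ → Type
  [normed : ∀ q, NormedAddCommGroup (C q)]
  [ipspace : ∀ q, InnerProductSpace ℂ (C q)]
  [findim : ∀ q, FiniteDimensional ℂ (C q)]
  /-- the differentials -/
  d : ∀ q, C q →ₗ[ℂ] C (q + 1)
  dd : ∀ q, (d (q + 1)).comp (d q) = 0
  trivial_beyond : ∀ q, N < q → ∀ x : C q, x = 0

attribute [instance] FinComplex.normed FinComplex.ipspace FinComplex.findim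

namespace FinComplex

variable {N : ℕ}

/-- The Laplacians `Δ_q = d_q^* d_q + d_{q-1} d_{q-1}^*` (no second term for `q = 0`). -/
def lap (X : FinComplex N) : ∀ q, X.C q →ₗ[ℂ] X.C q
  | 0 => (LinearMap.adjoint (X.d 0)).comp (X.d 0)
  | (q + 1) =>
      (LinearMap.adjoint (X.d (q + 1))).comp (X.d (q + 1)) +
        (X.d q).comp (LinearMap.adjoint (X.d q))

/-- Acyclicity: `ker d_q = range d_{q-1}` for every `q` (for `q = 0` this reads `ker d_0 = 0`). -/
def Acyclic (X : FinComplex N) : Prop :=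
  LinearMap.ker (X.d 0) = ⊥ ∧
    ∀ q, LinearMap.ker (X.d (q + 1)) = LinearMap.range (X.d q)

/-- `log T(C) = (1/2) * Σ_q (-1)^(q+1) * q * log det Δ_q`. -/
def logT (X : FinComplex N) : ℝ :=
  (1 / 2) * ∑ q ∈ Finset.range (N + 1),
      (-1 : ℝ) ^ (q + 1) * (q : ℝ) * Real.log ((LinearMap.det (X.lap q)).re)

/-- Morphism of cochain complexes. -/
def IsMorphism (X Y : FinComplex N) (f : ∀ q, X.C q →ₗ[ℂ] Y.C q) : Prop :=
  ∀ q x, f (q + 1) (X.d q x) = Y.d q (f q x)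

/-- `f` induces an isomorphism in cohomology
(`ker d_q / range d_{q-1} → ker d'_q / range d'_{q-1}` is bijective for all `q`). -/
def InducesCohomologyIso (X Y : FinComplex N) (f : ∀ q, X.C q →ₗ[ℂ] Y.C q) : Prop :=
  (∀ x : X.C 0, X.d 0 x = 0 → f 0 x = 0 → x = 0) ∧
  (∀ y : Y.C 0, Y.d 0 y = 0 → ∃ x : X.C 0, X.d 0 x = 0 ∧ f 0 x = y) ∧
  (∀ q, ∀ x : X.C (q + 1), X.d (q + 1) x = 0 →
      (∃ v, Y.d q v = f (q + 1) x) → ∃ u, X.d q u = x) ∧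
  (∀ q, ∀ y : Y.C (q + 1), Y.d (q + 1) y = 0 →
      ∃ x : X.C (q + 1), X.d (q + 1) x = 0 ∧ ∃ v, y - f (q + 1) x = Y.d q v)

/-- Data identifying `Z` with the mapping cone of `f : X → Y`:
`Z_k = Y_{k-1} ⊕ X_k` (orthogonal direct sum) with differential
`d(f)_k (v, u) = (-d_Y v + f u, d_X u)`. -/
structure ConeIso (X Y : FinComplex N) (f : ∀ q, X.C q →ₗ[ℂ] Y.C q)
    (Z : FinComplex (N + 1)) where
  e0 : X.C 0 ≃ₗᵢ[ℂ] Z.C 0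
  e : ∀ q, WithLp 2 (Y.C q × X.C (q + 1)) ≃ₗᵢ[ℂ] Z.C (q + 1)
  compat0 : ∀ u : X.C 0,
    Z.d 0 (e0 u) = e 0 ((WithLp.equiv 2 (Y.C 0 × X.C 1)).symm (f 0 u, X.d 0 u))
  compat : ∀ q (v : Y.C q) (u : X.C (q + 1)),
    Z.d (q + 1) (e q ((WithLp.equiv 2 (Y.C q × X.C (q + 1))).symm (v, u))) =
      e (q + 1) ((WithLp.equiv 2 (Y.C (q + 1) × X.C (q + 2))).symm
        (-(Y.d q v) + f (q + 1) u, X.d (q + 1) u))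

end FinComplex

/-- `log vol(g) = (1/2) log det (g^* g)` for a linear map between finite-dimensional
complex inner product spaces. -/
def logvol {E F : Type} [NormedAddCommGroup E] [InnerProductSpace ℂ E] [FiniteDimensional ℂ E]
    [NormedAddCommGroup F] [InnerProductSpace ℂ F] [FiniteDimensional ℂ F]
    (g : E →ₗ[ℂ] F) : ℝ :=
  (1 / 2) * Real.log ((LinearMap.det ((LinearMap.adjoint g).comp g)).re)

/-! ### Auxiliary material: Gram determinants and torsion of short exact sequences -/

section MilnorAux

open Matrix Module

/-- logarithm of the Gram determinant of a family -/
def lgram {E ι : Type} [NormedAddCommGroup E] [InnerProductSpace ℂ E] [Fintype ι] [DecidableEq ι]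
    (v : ι → E) : ℝ := Real.log ‖(Matrix.gram ℂ v).det‖

theorem gram_det_ne {E ι : Type} [NormedAddCommGroup E] [InnerProductSpace ℂ E] [Fintype ι]
    [DecidableEq ι] (b : Basis ι ℂ E) : (Matrix.gram ℂ b).det ≠ 0 :=
  Matrix.det_gram_ne_zero_iff_linearIndependent.2 b.linearIndependent

theorem gram_map_det {E F ι : Type} [NormedAddCommGroup E] [InnerProductSpace ℂ E]
    [FiniteDimensional ℂ E] [NormedAddCommGroup F] [InnerProductSpace ℂ F] [FiniteDimensional ℂ F]
    [Fintype ι] [DecidableEq ι] (b : Basis ι ℂ E) (f : E →ₗ[ℂ] F) :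
    (Matrix.gram ℂ (fun i => f (b i))).det =
      (Matrix.gram ℂ b).det * LinearMap.det ((LinearMap.adjoint f).comp f) := by
  have h : Matrix.gram ℂ (fun i => f (b i)) =
      Matrix.gram ℂ b * LinearMap.toMatrix b b ((LinearMap.adjoint f).comp f) := by
    ext i j
    rw [Matrix.mul_apply, Matrix.gram_apply, ← LinearMap.adjoint_inner_right]
    conv_lhs => rw [← b.sum_repr ((LinearMap.adjoint f) (f (b j)))]
    rw [inner_sum]
    refine Finset.sum_congr rfl fun k _ => ?_
    rw [inner_smul_right, LinearMap.toMatrix_apply, Matrix.gram_apply, mul_comm]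
    rfl
  rw [h, Matrix.det_mul, LinearMap.det_toMatrix]

theorem adj_comp_det_nonneg {E F : Type} [NormedAddCommGroup E] [InnerProductSpace ℂ E]
    [FiniteDimensional ℂ E] [NormedAddCommGroup F] [InnerProductSpace ℂ F] [FiniteDimensional ℂ F]
    (f : E →ₗ[ℂ] F) : ∃ r : ℝ, 0 ≤ r ∧ LinearMap.det ((LinearMap.adjoint f).comp f) = (r : ℂ) := by
  open scoped ComplexOrder in
  have h := gram_map_det (stdOrthonormalBasis ℂ E).toBasis f
  have h1 : Matrix.gram ℂ (stdOrthonormalBasis ℂ E).toBasis = 1 := by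
    rw [Matrix.gram_eq_one_iff_orthonormal]
    simp
  rw [h1, Matrix.det_one, one_mul] at h
  have h2 := (Matrix.posSemidef_gram ℂ
    (fun i => f ((stdOrthonormalBasis ℂ E).toBasis i))).det_nonneg
  rw [h] at h2
  obtain ⟨h3, h4⟩ := Complex.le_def.1 h2
  refine ⟨_, h3, ?_⟩
  apply Complex.ext
  · simp
  · simpa using h4.symm

theorem cross_gram {E ι : Type} [NormedAddCommGroup E] [InnerProductSpace ℂ E]
    [FiniteDimensional ℂ E] [Fintype ι] [DecidableEq ι] (b : Basis ι ℂ E) (w v : ι → E) :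
    ‖(Matrix.of fun i j => inner ℂ (w i) (v j)).det‖ ^ 2 =
      ‖(Matrix.gram ℂ w).det‖ * ‖(Matrix.gram ℂ v).det‖ := by
  have hc : Fintype.card (Fin (finrank ℂ E)) = Fintype.card ι := by
    rw [Fintype.card_fin, finrank_eq_card_basis b]
  let o : OrthonormalBasis ι ℂ E :=
    (stdOrthonormalBasis ℂ E).reindex (Fintype.equivOfCardEq hc)
  have h : (Matrix.of fun i j => inner ℂ (w i) (v j)) =
      (Matrix.of fun i j => o.repr (w j) i)ᴴ * (Matrix.of fun i j => o.repr (v j) i) := by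
    ext i j
    simp [mul_apply, o.repr_apply_apply, o.sum_inner_mul_inner]
  rw [h, Matrix.gram_eq_conjTranspose_mul o w, Matrix.gram_eq_conjTranspose_mul o v]
  simp only [Matrix.det_mul, Matrix.det_conjTranspose, norm_mul, norm_star]
  ring

/-- short exact sequences of vector spaces -/
structure SES {A B C : Type} [AddCommGroup A] [Module ℂ A] [AddCommGroup B] [Module ℂ B]
    [AddCommGroup C] [Module ℂ C] (i : A →ₗ[ℂ] B) (p : B →ₗ[ℂ] C) : Prop where
  inj : Function.Injective i
  surj : Function.Surjective p
  zero : ∀ x, p (i x) = 0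
  ex : ∀ y, p y = 0 → ∃ x, i x = y

theorem SES.basis {A B C ι κ : Type} [AddCommGroup A] [Module ℂ A] [AddCommGroup B] [Module ℂ B]
    [AddCommGroup C] [Module ℂ C] {i : A →ₗ[ℂ] B} {p : B →ₗ[ℂ] C} (h : SES i p)
    (a : Basis ι ℂ A) (c : Basis κ ℂ C) (t : κ → B) (ht : ∀ k, p (t k) = c k) :
    ∃ b : Basis (ι ⊕ κ) ℂ B, ⇑b = Sum.elim (fun k => i (a k)) t := by
  let s : C →ₗ[ℂ] B := c.constr ℂ t
  have hs : ∀ z, p (s z) = z := by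
    have : p.comp s = LinearMap.id := by
      apply c.ext
      intro k
      simp [s, ht]
    intro z
    exact LinearMap.congr_fun this z
  have hbij : Function.Bijective (LinearMap.coprod i s) := by
    constructor
    · rw [injective_iff_map_eq_zero]
      rintro ⟨x, z⟩ hx
      rw [LinearMap.coprod_apply] at hx
      have h1 := congrArg p hx
      rw [map_add, h.zero, hs, zero_add, map_zero] at h1
      simp only at h1
      subst h1
      rw [map_zero, add_zero] at hx
      have := h.inj (hx.trans (map_zero i).symm)
      simp only at this
      rw [this]; rfl
    · intro y
      obtain ⟨x, hx⟩ := h.ex (y - s (p y)) (by rw [map_sub, hs, sub_self])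
      exact ⟨(x, p y), by rw [LinearMap.coprod_apply, hx]; simp⟩
  refine ⟨(a.prod c).map (LinearEquiv.ofBijective _ hbij), ?_⟩
  funext k
  rcases k with k | k
  · simp
  · simp [s]

theorem SES.pp_inj {A B C : Type} [NormedAddCommGroup A] [InnerProductSpace ℂ A]
    [FiniteDimensional ℂ A] [NormedAddCommGroup B] [InnerProductSpace ℂ B]
    [FiniteDimensional ℂ B] [NormedAddCommGroup C] [InnerProductSpace ℂ C]
    [FiniteDimensional ℂ C] {i : A →ₗ[ℂ] B} {p : B →ₗ[ℂ] C} (h : SES i p) :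
    Function.Injective (p.comp (LinearMap.adjoint p)) := by
  rw [injective_iff_map_eq_zero]
  intro z hz
  have h1 : inner ℂ (LinearMap.adjoint p z) (LinearMap.adjoint p z) = 0 := by
    rw [LinearMap.adjoint_inner_left]
    have : p (LinearMap.adjoint p z) = 0 := hz
    rw [this, inner_zero_right]
  have h2 : LinearMap.adjoint p z = 0 := inner_self_eq_zero.1 h1
  obtain ⟨y, rfl⟩ := h.surj z
  have h3 : inner ℂ (p y) (p y) = 0 := by
    rw [← LinearMap.adjoint_inner_left, h2, inner_zero_left]
  exact inner_self_eq_zero.1 h3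

theorem det_ne_of_inj {C : Type} [AddCommGroup C] [Module ℂ C] [FiniteDimensional ℂ C]
    (f : C →ₗ[ℂ] C) (hf : Function.Injective f) : LinearMap.det f ≠ 0 := by
  have hu : IsUnit f := (LinearMap.isUnit_iff_ker_eq_bot f).2 (LinearMap.ker_eq_bot.2 hf)
  exact (hu.map LinearMap.det).ne_zero

/-- `x` is the logarithmic torsion of the short exact sequence `i, p`. -/
def IsTor {A B C : Type} [NormedAddCommGroup A] [InnerProductSpace ℂ A]
    [NormedAddCommGroup B] [InnerProductSpace ℂ B]
    [NormedAddCommGroup C] [InnerProductSpace ℂ C]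
    (i : A →ₗ[ℂ] B) (p : B →ₗ[ℂ] C) (x : ℝ) : Prop :=
  ∀ (ι κ : Type) [Fintype ι] [DecidableEq ι] [Fintype κ] [DecidableEq κ]
    (a : Basis ι ℂ A) (c : Basis κ ℂ C) (t : κ → B), (∀ k, p (t k) = c k) →
    lgram (Sum.elim (fun k => i (a k)) t) = 2 * x + lgram a + lgram c

/-- torsion by determinants -/
def tor {A B C : Type} [NormedAddCommGroup A] [InnerProductSpace ℂ A]
    [FiniteDimensional ℂ A] [NormedAddCommGroup B] [InnerProductSpace ℂ B]
    [FiniteDimensional ℂ B] [NormedAddCommGroup C] [InnerProductSpace ℂ C]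
    [FiniteDimensional ℂ C] (i : A →ₗ[ℂ] B) (p : B →ₗ[ℂ] C) : ℝ :=
  (1 / 2) * (Real.log ‖LinearMap.det ((LinearMap.adjoint i).comp i)‖ -
    Real.log ‖LinearMap.det (p.comp (LinearMap.adjoint p))‖)

theorem SES.isTor {A B C : Type} [NormedAddCommGroup A] [InnerProductSpace ℂ A]
    [FiniteDimensional ℂ A] [NormedAddCommGroup B] [InnerProductSpace ℂ B]
    [FiniteDimensional ℂ B] [NormedAddCommGroup C] [InnerProductSpace ℂ C]
    [FiniteDimensional ℂ C] {i : A →ₗ[ℂ] B} {p : B →ₗ[ℂ] C} (h : SES i p) :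
    IsTor i p (tor i p) := by
  intro ι κ _ _ _ _ a c t ht
  obtain ⟨b, hb⟩ := h.basis a c t ht
  have hz : ∀ x y, inner ℂ (i x) (LinearMap.adjoint p y) = 0 := by
    intro x y
    rw [LinearMap.adjoint_inner_right, h.zero, inner_zero_left]
  have hz' : ∀ x y, inner ℂ (LinearMap.adjoint p y) (i x) = 0 := by
    intro x y
    rw [LinearMap.adjoint_inner_left, h.zero, inner_zero_right]
  have hia := gram_map_det a i
  have hpc := gram_map_det c (LinearMap.adjoint p)
  rw [LinearMap.adjoint_adjoint] at hpc
  have hw : (Matrix.gram ℂ (Sum.elim (fun k => i (a k))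
      (fun k => LinearMap.adjoint p (c k)))).det =
      (Matrix.gram ℂ (fun k => i (a k))).det *
        (Matrix.gram ℂ (fun k => LinearMap.adjoint p (c k))).det := by
    rw [← Matrix.det_fromBlocks_zero₂₁ _ 0]
    congr 1
    ext j k
    rcases j with j | j <;> rcases k with k | k <;> simp [hz, hz']
  have hx : (Matrix.of fun j k => inner ℂ ((Sum.elim (fun k => i (a k))
      (fun k => LinearMap.adjoint p (c k))) j) ((Sum.elim (fun k => i (a k)) t) k)).det =
      (Matrix.gram ℂ (fun k => i (a k))).det * (Matrix.gram ℂ c).det := by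
    rw [← Matrix.det_fromBlocks_zero₂₁ _ (Matrix.of fun j k => inner ℂ (i (a j)) (t k))]
    congr 1
    ext j k
    rcases j with j | j <;> rcases k with k | k <;>
      simp [hz', LinearMap.adjoint_inner_left, ht]
  have hcr := cross_gram b (Sum.elim (fun k => i (a k)) (fun k => LinearMap.adjoint p (c k)))
    (Sum.elim (fun k => i (a k)) t)
  rw [hx, hw, hia, hpc] at hcr
  have hv : (Matrix.gram ℂ (Sum.elim (fun k => i (a k)) t)).det ≠ 0 := by
    rw [← hb]; exact gram_det_ne b
  have n1 := gram_det_ne a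
  have n2 := gram_det_ne c
  have n3 := det_ne_of_inj _ h.pp_inj
  have n4 : LinearMap.det ((LinearMap.adjoint i).comp i) ≠ 0 := by
    intro h0
    rw [h0, mul_zero] at hia
    refine Matrix.det_gram_ne_zero_iff_linearIndependent.2 ?_ hia
    exact a.linearIndependent.map' i (LinearMap.ker_eq_bot.2 h.inj)
  rw [← norm_ne_zero_iff] at hv n1 n2 n3 n4
  have hl := congrArg Real.log hcr
  simp only [norm_mul] at hl
  rw [Real.log_pow, Real.log_mul (by positivity) (by positivity),
    Real.log_mul (by positivity) (by positivity), Real.log_mul (by positivity) (by positivity),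
    Real.log_mul (by positivity) (by positivity), Real.log_mul (by positivity) (by positivity),
    Real.log_mul n2 n3] at hl
  unfold lgram tor
  push_cast at hl
  linarith

theorem lgram_reindex {E ι κ : Type} [NormedAddCommGroup E] [InnerProductSpace ℂ E] [Fintype ι]
    [DecidableEq ι] [Fintype κ] [DecidableEq κ] (e : ι ≃ κ) (v : κ → E) :
    lgram (fun i => v (e i)) = lgram v := by
  unfold lgram
  rw [← Matrix.det_submatrix_equiv_self e (Matrix.gram ℂ v)]
  rfl

theorem lgram_isom {E F ι : Type} [NormedAddCommGroup E] [InnerProductSpace ℂ E]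
    [NormedAddCommGroup F] [InnerProductSpace ℂ F] [Fintype ι]
    [DecidableEq ι] (e : E ≃ₗᵢ[ℂ] F) (v : ι → E) :
    lgram (fun i => e (v i)) = lgram v := by
  unfold lgram
  congr 3
  ext i j
  simp

theorem three_by_three
    {A11 A12 A13 A21 A22 A23 A31 A32 A33 : Type}
    [NormedAddCommGroup A11] [InnerProductSpace ℂ A11] [FiniteDimensional ℂ A11]
    [NormedAddCommGroup A12] [InnerProductSpace ℂ A12]
    [NormedAddCommGroup A13] [InnerProductSpace ℂ A13] [FiniteDimensional ℂ A13]
    [NormedAddCommGroup A21] [InnerProductSpace ℂ A21]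
    [NormedAddCommGroup A22] [InnerProductSpace ℂ A22]
    [NormedAddCommGroup A23] [InnerProductSpace ℂ A23]
    [NormedAddCommGroup A31] [InnerProductSpace ℂ A31] [FiniteDimensional ℂ A31]
    [NormedAddCommGroup A32] [InnerProductSpace ℂ A32]
    [NormedAddCommGroup A33] [InnerProductSpace ℂ A33] [FiniteDimensional ℂ A33]
    {r1 : A11 →ₗ[ℂ] A12} {s1 : A12 →ₗ[ℂ] A13} {r2 : A21 →ₗ[ℂ] A22} {s2 : A22 →ₗ[ℂ] A23}
    {r3 : A31 →ₗ[ℂ] A32} {s3 : A32 →ₗ[ℂ] A33}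
    {c1 : A11 →ₗ[ℂ] A21} {e1 : A21 →ₗ[ℂ] A31} {c2 : A12 →ₗ[ℂ] A22} {e2 : A22 →ₗ[ℂ] A32}
    {c3 : A13 →ₗ[ℂ] A23} {e3 : A23 →ₗ[ℂ] A33}
    (q1 : ∀ x, c2 (r1 x) = r2 (c1 x)) (q2 : ∀ x, c3 (s1 x) = s2 (c2 x))
    (q3 : ∀ x, e2 (r2 x) = r3 (e1 x)) (q4 : ∀ x, e3 (s2 x) = s3 (e2 x))
    (hr1 : SES r1 s1) (hr2 : SES r2 s2) (hr3 : SES r3 s3)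
    (hc1 : SES c1 e1) (hc3 : SES c3 e3)
    {x1 x2 x3 y1 y2 y3 : ℝ} (tx1 : IsTor r1 s1 x1) (tx2 : IsTor r2 s2 x2) (tx3 : IsTor r3 s3 x3)
    (ty1 : IsTor c1 e1 y1) (ty2 : IsTor c2 e2 y2) (ty3 : IsTor c3 e3 y3) :
    x1 - x2 + x3 = y1 - y2 + y3 := by
  let a11 := finBasis ℂ A11
  let a13 := finBasis ℂ A13
  let a31 := finBasis ℂ A31
  let a33 := finBasis ℂ A33
  choose t13 h13 using fun k => hr1.surj (a13 k)
  choose t31 h31 using fun k => hc1.surj (a31 k)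
  choose u33 k33 using fun k => hc3.surj (a33 k)
  choose t33 h33 using fun k => hr2.surj (u33 k)
  have k23 : ∀ k, e3 (s2 (t33 k)) = a33 k := fun k => by rw [h33, k33]
  have k32 : ∀ k, s3 (e2 (t33 k)) = a33 k := fun k => by rw [← q4, k23]
  obtain ⟨b12, hb12⟩ := hr1.basis a11 a13 t13 h13
  obtain ⟨b21, hb21⟩ := hc1.basis a11 a31 t31 h31
  obtain ⟨b23, hb23⟩ := hc3.basis a13 a33 (fun k => s2 (t33 k)) k23
  obtain ⟨b32, hb32⟩ := hr3.basis a31 a33 (fun k => e2 (t33 k)) k32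
  have l12 := tx1 _ _ a11 a13 t13 h13
  have l21 := ty1 _ _ a11 a31 t31 h31
  have l23 := ty3 _ _ a13 a33 (fun k => s2 (t33 k)) k23
  have l32 := tx3 _ _ a31 a33 (fun k => e2 (t33 k)) k32
  have lr := tx2 _ _ b21 b23 (Sum.elim (fun k => c2 (t13 k)) t33) (by
    rw [hb23]
    rintro (k | k)
    · simp [← q2, h13]
    · simp)
  have lc := ty2 _ _ b12 b32 (Sum.elim (fun k => r2 (t31 k)) t33) (by
    rw [hb32]
    rintro (k | k)
    · simp [q3, h31]
    · simp)
  have key : (Sum.elim (fun k => r2 (b21 k)) (Sum.elim (fun k => c2 (t13 k)) t33)) =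
      fun j => (Sum.elim (fun k => c2 (b12 k)) (Sum.elim (fun k => r2 (t31 k)) t33))
        (Equiv.sumSumSumComm _ _ _ _ j) := by
    rw [hb12, hb21]
    funext j
    rcases j with (j | j) | (j | j) <;> simp [q1]
  rw [key, lgram_reindex] at lr
  rw [← hb12] at l12
  rw [← hb21] at l21
  rw [← hb23] at l23
  rw [← hb32] at l32
  linarith

/-- determinant of a block operator on the middle term of a short exact sequence -/
theorem SES.det_mid {A B C : Type} [NormedAddCommGroup A] [InnerProductSpace ℂ A]
    [FiniteDimensional ℂ A] [NormedAddCommGroup B] [InnerProductSpace ℂ B]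
    [FiniteDimensional ℂ B] [NormedAddCommGroup C] [InnerProductSpace ℂ C]
    [FiniteDimensional ℂ C] {i : A →ₗ[ℂ] B} {p : B →ₗ[ℂ] C} (h : SES i p)
    (D : B →ₗ[ℂ] B) (W : A →ₗ[ℂ] A) (V : C →ₗ[ℂ] C)
    (h1 : ∀ x, D (i x) = i (W x))
    (h2 : ∀ z, D (LinearMap.adjoint p z) = LinearMap.adjoint p (V z)) :
    LinearMap.det D = LinearMap.det W * LinearMap.det V := by
  have hpp := h.pp_inj
  have hps : Function.Surjective (p.comp (LinearMap.adjoint p)) :=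
    LinearMap.injective_iff_surjective.1 hpp
  have hbij : Function.Bijective (LinearMap.coprod i (LinearMap.adjoint p)) := by
    constructor
    · rw [injective_iff_map_eq_zero]
      rintro ⟨x, z⟩ hx
      rw [LinearMap.coprod_apply] at hx
      have h1 := congrArg p hx
      rw [map_add, h.zero, zero_add, map_zero] at h1
      have h1' : z = 0 := hpp (by simpa using h1)
      subst h1'
      rw [map_zero, add_zero] at hx
      have := h.inj (hx.trans (map_zero i).symm)
      simp only at this
      rw [this]; rfl
    · intro y
      obtain ⟨z, hz⟩ := hps (p y)
      have hz' : p (LinearMap.adjoint p z) = p y := hz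
      obtain ⟨x, hx⟩ := h.ex (y - LinearMap.adjoint p z) (by rw [map_sub, hz', sub_self])
      exact ⟨(x, z), by rw [LinearMap.coprod_apply, hx]; simp⟩
  let e := LinearEquiv.ofBijective _ hbij
  have hD : D = (e : A × C →ₗ[ℂ] B).comp ((W.prodMap V).comp (e.symm : B →ₗ[ℂ] A × C)) := by
    ext y
    obtain ⟨⟨x, z⟩, rfl⟩ := e.surjective y
    rw [LinearMap.comp_apply, LinearMap.comp_apply, LinearEquiv.coe_coe, LinearEquiv.coe_coe,
      LinearEquiv.symm_apply_apply, LinearMap.prodMap_apply]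
    change D (LinearMap.coprod i (LinearMap.adjoint p) (x, z)) =
      LinearMap.coprod i (LinearMap.adjoint p) (W x, V z)
    rw [LinearMap.coprod_apply, LinearMap.coprod_apply, map_add, h1, h2]
  rw [hD, LinearMap.det_conj, LinearMap.det_prodMap]

end MilnorAux

namespace FinComplex

variable {N : ℕ}

/-- cocycles -/
abbrev Z (X : FinComplex N) (q : ℕ) : Submodule ℂ (X.C q) := LinearMap.ker (X.d q)

/-- differential as a map onto the cocycles -/
def pr (X : FinComplex N) (q : ℕ) : X.C q →ₗ[ℂ] X.Z (q + 1) :=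
  LinearMap.codRestrict _ (X.d q) (fun x => LinearMap.congr_fun (X.dd q) x)

theorem pr_coe (X : FinComplex N) (q : ℕ) (x : X.C q) : (X.pr q x : X.C (q + 1)) = X.d q x := rfl

theorem Acyclic.ses {X : FinComplex N} (h : X.Acyclic) (q : ℕ) :
    SES (X.Z q).subtype (X.pr q) where
  inj := Subtype.val_injective
  surj := by
    rintro ⟨z, hz⟩
    have hz' : z ∈ LinearMap.range (X.d q) := by rw [← h.2 q]; exact hz
    obtain ⟨y, hy⟩ := hz'
    exact ⟨y, Subtype.ext hy⟩
  zero := by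
    rintro ⟨x, hx⟩
    exact Subtype.ext hx
  ex := by
    intro y hy
    exact ⟨⟨y, congrArg Subtype.val hy⟩, rfl⟩

/-- `d d^*` on cocycles -/
def V (X : FinComplex N) (q : ℕ) : X.Z (q + 1) →ₗ[ℂ] X.Z (q + 1) :=
  (X.pr q).comp (LinearMap.adjoint (X.pr q))

theorem pr_adj_pr (X : FinComplex N) (q : ℕ) (x : X.C q) :
    LinearMap.adjoint (X.d q) (X.d q x) = LinearMap.adjoint (X.pr q) (X.pr q x) := by
  refine ext_inner_left ℂ fun y => ?_
  rw [LinearMap.adjoint_inner_right, LinearMap.adjoint_inner_right]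
  rfl

theorem adj_Z (X : FinComplex N) (q : ℕ) (z : X.Z (q + 1)) :
    LinearMap.adjoint (X.d q) (z : X.C (q + 1)) = LinearMap.adjoint (X.pr q) z := by
  refine ext_inner_left ℂ fun y => ?_
  rw [LinearMap.adjoint_inner_right, LinearMap.adjoint_inner_right]
  rfl

theorem adj_adj (X : FinComplex N) (q : ℕ) (z : X.Z (q + 1 + 1)) :
    LinearMap.adjoint (X.d q) (LinearMap.adjoint (X.pr (q + 1)) z) = 0 := by
  refine ext_inner_left ℂ fun y => ?_
  rw [LinearMap.adjoint_inner_right, LinearMap.adjoint_inner_right, inner_zero_right]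
  have : X.pr (q + 1) (X.d q y) = 0 := Subtype.ext (LinearMap.congr_fun (X.dd q) y)
  rw [this, inner_zero_left]

theorem Acyclic.det_lap_zero {X : FinComplex N} (h : X.Acyclic) :
    LinearMap.det (X.lap 0) = LinearMap.det (X.V 0) := by
  rw [(h.ses 0).det_mid (X.lap 0) LinearMap.id (X.V 0), LinearMap.det_id, one_mul]
  · rintro ⟨x, hx⟩
    have hx0 : x = 0 := by
      have : x ∈ LinearMap.ker (X.d 0) := hx
      rw [h.1] at this
      simpa using this
    subst hx0
    simp
  · intro z
    change LinearMap.adjoint (X.d 0) (X.d 0 _) = _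
    rw [pr_adj_pr]
    rfl

theorem Acyclic.det_lap_succ {X : FinComplex N} (h : X.Acyclic) (q : ℕ) :
    LinearMap.det (X.lap (q + 1)) = LinearMap.det (X.V q) * LinearMap.det (X.V (q + 1)) := by
  refine (h.ses (q + 1)).det_mid (X.lap (q + 1)) (X.V q) (X.V (q + 1)) ?_ ?_
  · intro x
    change LinearMap.adjoint (X.d (q + 1)) (X.d (q + 1) x) +
      X.d q (LinearMap.adjoint (X.d q) x) = _
    rw [adj_Z, show X.d (q + 1) (x : X.C (q + 1)) = 0 from x.2, map_zero, zero_add]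
    rfl
  · intro z
    change LinearMap.adjoint (X.d (q + 1)) (X.d (q + 1) _) +
      X.d q (LinearMap.adjoint (X.d q) _) = _
    rw [adj_adj, map_zero, add_zero, pr_adj_pr]
    rfl

/-- log determinants of `V` -/
def L (X : FinComplex N) (q : ℕ) : ℝ := Real.log ‖LinearMap.det (X.V q)‖

theorem V_nonneg (X : FinComplex N) (q : ℕ) :
    ∃ r : ℝ, 0 ≤ r ∧ LinearMap.det (X.V q) = (r : ℂ) := by
  have := adj_comp_det_nonneg (LinearMap.adjoint (X.pr q))
  rwa [LinearMap.adjoint_adjoint] at this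

theorem Acyclic.log_lap_succ {X : FinComplex N} (h : X.Acyclic) (q : ℕ) :
    Real.log ((LinearMap.det (X.lap (q + 1))).re) = X.L q + X.L (q + 1) := by
  rw [h.det_lap_succ]
  unfold L
  have n1 := det_ne_of_inj _ (h.ses q).pp_inj
  have n2 := det_ne_of_inj _ (h.ses (q + 1)).pp_inj
  change LinearMap.det (X.V q) ≠ 0 at n1
  change LinearMap.det (X.V (q + 1)) ≠ 0 at n2
  obtain ⟨r, hr, er⟩ := X.V_nonneg q
  obtain ⟨s, hs, es⟩ := X.V_nonneg (q + 1)
  rw [er] at n1 ⊢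
  rw [es] at n2 ⊢
  rw [← Complex.ofReal_mul, Complex.ofReal_re, Complex.norm_real, Complex.norm_real,
    Real.norm_of_nonneg hr, Real.norm_of_nonneg hs]
  exact Real.log_mul (by exact_mod_cast n1) (by exact_mod_cast n2)

theorem L_top (X : FinComplex N) : X.L N = 0 := by
  have : Subsingleton (X.Z (N + 1)) := by
    refine ⟨fun a b => Subtype.ext ?_⟩
    rw [X.trivial_beyond (N + 1) (by omega) a, X.trivial_beyond (N + 1) (by omega) b]
  unfold L
  rw [LinearMap.det_eq_one_of_subsingleton]
  simp

theorem sum_aux (l D : ℕ → ℝ) (h : ∀ q, D (q + 1) = l q + l (q + 1)) (n : ℕ) :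
    ∑ q ∈ Finset.range (n + 1), (-1 : ℝ) ^ (q + 1) * (q : ℝ) * D q =
      ∑ q ∈ Finset.range n, (-1 : ℝ) ^ q * l q + (-1 : ℝ) ^ (n + 1) * n * l n := by
  induction n with
  | zero => simp
  | succ n ih =>
    rw [Finset.sum_range_succ, ih, Finset.sum_range_succ _ n, h]
    push_cast
    ring

theorem Acyclic.logT_eq {X : FinComplex N} (h : X.Acyclic) :
    X.logT = (1 / 2) * ∑ q ∈ Finset.range (N + 1), (-1 : ℝ) ^ q * X.L q := by
  unfold logT
  rw [sum_aux X.L _ h.log_lap_succ N, Finset.sum_range_succ, L_top]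
  simp

theorem Acyclic.row_tor {X : FinComplex N} (h : X.Acyclic) (q : ℕ) :
    IsTor (X.Z q).subtype (X.pr q) (-(1 / 2) * X.L q) := by
  have := (h.ses q).isTor
  convert this using 1
  unfold tor L
  have h1 : (LinearMap.adjoint (X.Z q).subtype).comp (X.Z q).subtype = LinearMap.id := by
    ext1 x
    refine ext_inner_left ℂ fun y => ?_
    rw [LinearMap.comp_apply, LinearMap.adjoint_inner_right]
    rfl
  rw [h1]
  simp [V]

/-- map on cocycles -/
def zmap {X Y : FinComplex N} (f : ∀ q, X.C q →ₗ[ℂ] Y.C q) (hf : IsMorphism X Y f) (q : ℕ) :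
    X.Z q →ₗ[ℂ] Y.Z q :=
  (f q).restrict (fun x hx => by
    rw [LinearMap.mem_ker] at hx ⊢
    rw [← hf, hx, map_zero])

theorem zmap_coe {X Y : FinComplex N} (f : ∀ q, X.C q →ₗ[ℂ] Y.C q) (hf : IsMorphism X Y f)
    (q : ℕ) (x : X.Z q) : (zmap f hf q x : Y.C q) = f q x := rfl

theorem zses {X1 X2 X3 : FinComplex N}
    (I : ∀ q, X1.C q →ₗ[ℂ] X2.C q) (P : ∀ q, X2.C q →ₗ[ℂ] X3.C q)
    (hI : IsMorphism X1 X2 I) (hP : IsMorphism X2 X3 P) (hs : ∀ q, SES (I q) (P q))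
    (h3 : X3.Acyclic) (q : ℕ) : SES (zmap I hI q) (zmap P hP q) where
  inj := by
    intro x y hxy
    exact Subtype.ext ((hs q).inj (congrArg Subtype.val hxy))
  surj := by
    rintro ⟨z, hz⟩
    cases q with
    | zero =>
      have : z ∈ LinearMap.ker (X3.d 0) := hz
      rw [h3.1] at this
      have hz0 : z = 0 := by simpa using this
      subst hz0
      exact ⟨0, map_zero _⟩
    | succ q =>
      have hz' : z ∈ LinearMap.range (X3.d q) := by rw [← h3.2 q]; exact hz
      obtain ⟨y, hy⟩ := hz'
      obtain ⟨x, hx⟩ := (hs q).surj y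
      refine ⟨X2.pr q x, Subtype.ext ?_⟩
      rw [zmap_coe, pr_coe, hP, hx, hy]
  zero := fun x => Subtype.ext ((hs q).zero x)
  ex := by
    rintro ⟨y, hy⟩ h
    obtain ⟨x, hx⟩ := (hs q).ex y (congrArg Subtype.val h)
    refine ⟨⟨x, ?_⟩, Subtype.ext hx⟩
    rw [LinearMap.mem_ker]
    apply (hs (q + 1)).inj
    rw [hI, hx, map_zero]
    exact hy

theorem tor_trivial {A B C : Type} [NormedAddCommGroup A] [InnerProductSpace ℂ A]
    [FiniteDimensional ℂ A] [NormedAddCommGroup B] [InnerProductSpace ℂ B]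
    [FiniteDimensional ℂ B] [NormedAddCommGroup C] [InnerProductSpace ℂ C]
    [FiniteDimensional ℂ C] (i : A →ₗ[ℂ] B) (p : B →ₗ[ℂ] C)
    (hA : Subsingleton A) (hC : Subsingleton C) : tor i p = 0 := by
  unfold tor
  rw [LinearMap.det_eq_one_of_subsingleton, LinearMap.det_eq_one_of_subsingleton]
  simp

theorem three_logT (S : FinComplex 2) (h : SES (S.d 0) (S.d 1)) :
    S.logT = tor (S.d 0) (S.d 1) := by
  have hd2 : S.d 2 = 0 := by
    ext x
    exact S.trivial_beyond 3 (by omega) _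
  have l2 : S.lap 2 = (S.d 1).comp (LinearMap.adjoint (S.d 1)) := by
    change (LinearMap.adjoint (S.d 2)).comp (S.d 2) + _ = _
    rw [hd2, LinearMap.comp_zero, zero_add]
  have l1 : LinearMap.det (S.lap 1) = LinearMap.det ((LinearMap.adjoint (S.d 0)).comp (S.d 0)) *
      LinearMap.det ((S.d 1).comp (LinearMap.adjoint (S.d 1))) := by
    refine h.det_mid _ _ _ ?_ ?_
    · intro x
      change LinearMap.adjoint (S.d 1) (S.d 1 _) + S.d 0 (LinearMap.adjoint (S.d 0) _) = _
      rw [h.zero, map_zero, zero_add]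
      rfl
    · intro z
      change LinearMap.adjoint (S.d 1) (S.d 1 _) + S.d 0 (LinearMap.adjoint (S.d 0) _) = _
      have : LinearMap.adjoint (S.d 0) (LinearMap.adjoint (S.d 1) z) = 0 := by
        refine ext_inner_left ℂ fun y => ?_
        rw [LinearMap.adjoint_inner_right, LinearMap.adjoint_inner_right, h.zero]
        simp
      rw [this, map_zero, add_zero]
      rfl
  have n2 := det_ne_of_inj _ h.pp_inj
  have n1 : LinearMap.det ((LinearMap.adjoint (S.d 0)).comp (S.d 0)) ≠ 0 := by
    apply det_ne_of_inj
    rw [injective_iff_map_eq_zero]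
    intro x hx
    apply h.inj
    rw [map_zero, ← inner_self_eq_zero (𝕜 := ℂ), ← LinearMap.adjoint_inner_right]
    have : LinearMap.adjoint (S.d 0) (S.d 0 x) = 0 := hx
    rw [this, inner_zero_right]
  obtain ⟨r, hr, er⟩ := adj_comp_det_nonneg (S.d 0)
  obtain ⟨s, hs, es⟩ := adj_comp_det_nonneg (LinearMap.adjoint (S.d 1))
  rw [LinearMap.adjoint_adjoint] at es
  unfold logT tor
  simp only [Finset.sum_range_succ, Finset.sum_range_zero]
  rw [l1, l2]
  rw [er] at n1 ⊢
  rw [es] at n2 ⊢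
  rw [← Complex.ofReal_mul, Complex.ofReal_re, Complex.ofReal_re, Complex.norm_real,
    Complex.norm_real, Real.norm_of_nonneg hr, Real.norm_of_nonneg hs,
    Real.log_mul (by exact_mod_cast n1) (by exact_mod_cast n2)]
  push_cast
  ring

theorem three_isTor (S : FinComplex 2) {A B C : Type}
    [NormedAddCommGroup A] [InnerProductSpace ℂ A]
    [NormedAddCommGroup B] [InnerProductSpace ℂ B]
    [NormedAddCommGroup C] [InnerProductSpace ℂ C]
    {i : A →ₗ[ℂ] B} {p : B →ₗ[ℂ] C} (h : SES i p)
    (a : S.C 0 ≃ₗᵢ[ℂ] A) (b : S.C 1 ≃ₗᵢ[ℂ] B) (c : S.C 2 ≃ₗᵢ[ℂ] C)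
    (hi : ∀ x : S.C 0, b (S.d 0 x) = i (a x))
    (hp : ∀ y : S.C 1, c (S.d 1 y) = p (b y)) : IsTor i p S.logT := by
  have hS : SES (S.d 0) (S.d 1) :=
    { inj := by
        intro x y hxy
        apply a.injective
        apply h.inj
        rw [← hi, ← hi, hxy]
      surj := by
        intro z
        obtain ⟨y, hy⟩ := h.surj (c z)
        refine ⟨b.symm y, c.injective ?_⟩
        rw [hp, LinearIsometryEquiv.apply_symm_apply, hy]
      zero := fun x => LinearMap.congr_fun (S.dd 0) x
      ex := by
        intro y hy
        obtain ⟨x, hx⟩ := h.ex (b y) (by rw [← hp, hy, map_zero])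
        refine ⟨a.symm x, b.injective ?_⟩
        rw [hi, LinearIsometryEquiv.apply_symm_apply, hx] }
  rw [three_logT S hS]
  intro ι κ _ _ _ _ u w t ht
  have := hS.isTor ι κ (u.map a.symm.toLinearEquiv) (w.map c.symm.toLinearEquiv)
    (fun k => b.symm (t k)) (by
      intro k
      apply c.injective
      rw [hp, LinearIsometryEquiv.apply_symm_apply, ht]
      simp)
  rw [← lgram_isom b, ← lgram_isom a, ← lgram_isom c] at this
  convert this using 2
  · funext k
    rcases k with k | k
    · simp [hi]
    · simp
  · congr 2
    funext k
    simp
  · congr 1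
    funext k
    simp

end FinComplex

open FinComplex in
/-- **Milnor's lemma (Proposition 1.10 of [BFK, "Relative torsion"])** in the
finite-dimensional case `𝒜 = ℂ`, with all three complexes acyclic.  For a short exact
sequence `0 → C¹ →^I C² →^P C³ → 0` of acyclic cochain complexes of finite-dimensional
complex inner product spaces,
`log T(C²) = log T(C¹) + log T(C³) - Σ_i (-1)^i log T(S_i)`, where `S_i` is the acyclic
three-term complex `0 → C¹_i → C²_i → C³_i → 0` placed in degrees `0, 1, 2`. -/
theorem milnor_torsion_exact_sequence (N : ℕ) (X1 X2 X3 : FinComplex N)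
    (I : ∀ q, X1.C q →ₗ[ℂ] X2.C q) (P : ∀ q, X2.C q →ₗ[ℂ] X3.C q)
    (hI : IsMorphism X1 X2 I) (hP : IsMorphism X2 X3 P)
    (hinj : ∀ q, Function.Injective (I q))
    (hsurj : ∀ q, Function.Surjective (P q))
    (hexact : ∀ q, LinearMap.range (I q) = LinearMap.ker (P q))
    (h1 : X1.Acyclic) (h2 : X2.Acyclic) (h3 : X3.Acyclic)
    (S : ℕ → FinComplex 2)
    (hS : ∀ q, ∃ (a : (S q).C 0 ≃ₗᵢ[ℂ] X1.C q) (b : (S q).C 1 ≃ₗᵢ[ℂ] X2.C q)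
        (c : (S q).C 2 ≃ₗᵢ[ℂ] X3.C q),
      (∀ x : (S q).C 0, b ((S q).d 0 x) = I q (a x)) ∧
      (∀ y : (S q).C 1, c ((S q).d 1 y) = P q (b y))) :
    X2.logT = X1.logT + X3.logT -
      ∑ q ∈ Finset.range (N + 1), (-1 : ℝ) ^ q * (S q).logT := by
  have hs : ∀ q, SES (I q) (P q) := fun q =>
    { inj := hinj q
      surj := hsurj q
      zero := fun x => by
        have : I q x ∈ LinearMap.ker (P q) := by rw [← hexact]; exact ⟨x, rfl⟩
        exact this
      ex := fun y hy => by
        have : y ∈ LinearMap.range (I q) := by rw [hexact]; exact hy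
        exact this }
  have hST : ∀ q, IsTor (I q) (P q) (S q).logT := by
    intro q
    obtain ⟨a, b, c, hi, hp⟩ := hS q
    exact three_isTor (S q) (hs q) a b c hi hp
  have hz := zses I P hI hP hs h3
  have key : ∀ q, -(1 / 2) * X1.L q - -(1 / 2) * X2.L q + -(1 / 2) * X3.L q =
      tor (zmap I hI q) (zmap P hP q) - (S q).logT +
        tor (zmap I hI (q + 1)) (zmap P hP (q + 1)) := fun q =>
    three_by_three (r1 := (X1.Z q).subtype) (s1 := X1.pr q) (r2 := (X2.Z q).subtype)
      (s2 := X2.pr q) (r3 := (X3.Z q).subtype) (s3 := X3.pr q)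
      (c1 := zmap I hI q) (e1 := zmap P hP q) (c2 := I q) (e2 := P q)
      (c3 := zmap I hI (q + 1)) (e3 := zmap P hP (q + 1)) (fun _ => rfl)
      (fun x => Subtype.ext (hI q x)) (fun _ => rfl) (fun x => Subtype.ext (hP q x))
      (h1.ses q) (h2.ses q) (h3.ses q) (hz q) (hz (q + 1))
      (h1.row_tor q) (h2.row_tor q) (h3.row_tor q) (hz q).isTor (hST q) (hz (q + 1)).isTor
  have sub0 : ∀ X : FinComplex N, X.Acyclic → Subsingleton (X.Z 0) := by
    intro X hX
    unfold Z
    rw [hX.1]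
    infer_instance
  have subN : ∀ X : FinComplex N, Subsingleton (X.Z (N + 1)) := by
    intro X
    refine ⟨fun a b => Subtype.ext ?_⟩
    rw [X.trivial_beyond (N + 1) (by omega) a, X.trivial_beyond (N + 1) (by omega) b]
  have t0 : tor (zmap I hI 0) (zmap P hP 0) = 0 :=
    tor_trivial _ _ (sub0 X1 h1) (sub0 X3 h3)
  have tN : tor (zmap I hI (N + 1)) (zmap P hP (N + 1)) = 0 :=
    tor_trivial _ _ (subN X1) (subN X3)
  have tele : ∀ n, ∑ q ∈ Finset.range n, (-1 : ℝ) ^ q * (tor (zmap I hI q) (zmap P hP q) +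
      tor (zmap I hI (q + 1)) (zmap P hP (q + 1))) =
      - (-1 : ℝ) ^ n * tor (zmap I hI n) (zmap P hP n) := by
    intro n
    induction n with
    | zero => simp [t0]
    | succ n ih =>
      rw [Finset.sum_range_succ, ih]
      ring
  have ht := tele (N + 1)
  rw [tN, mul_zero] at ht
  have hsum : ∑ q ∈ Finset.range (N + 1), (-1 : ℝ) ^ q *
      (tor (zmap I hI q) (zmap P hP q) + tor (zmap I hI (q + 1)) (zmap P hP (q + 1))) =
      ∑ q ∈ Finset.range (N + 1), (-1 : ℝ) ^ q * (S q).logT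
        - 1 / 2 * ∑ q ∈ Finset.range (N + 1), (-1 : ℝ) ^ q * X1.L q
        + 1 / 2 * ∑ q ∈ Finset.range (N + 1), (-1 : ℝ) ^ q * X2.L q
        - 1 / 2 * ∑ q ∈ Finset.range (N + 1), (-1 : ℝ) ^ q * X3.L q := by
    rw [Finset.mul_sum, Finset.mul_sum, Finset.mul_sum, ← Finset.sum_sub_distrib,
      ← Finset.sum_add_distrib, ← Finset.sum_sub_distrib]
    refine Finset.sum_congr rfl fun q _ => ?_
    linear_combination (-(-1 : ℝ) ^ q) * key q
  rw [h1.logT_eq, h2.logT_eq, h3.logT_eq]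
  linarith
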